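/- Let u ∈ C_0^∞(Z) be complex-valued on an open set Z ⊂ ℝ² ≅ ℂ, let φ : Z → ℝ be smooth with bounded Laplacian, and let h > 0. Define P_h u = e^{φ/h}·(2h/i)·∂̄(e^{-φ/h} u), where ∂̄ = (1/2)(∂_x + i∂_y). Then ‖P_h u‖²_{L²(Z)} ≥ h·⟨(Δφ)·u, u⟩_{L²(Z)}. -/

import Mathlib

noncomputable section

/-- The Cauchy–Riemann operator `∂̄ = (1/2)(∂_x + i ∂_y)` on functions of one complex
variable. -/
def dbar (f : ℂ → ℂ) (z : ℂ) : ℂ :=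
  (1 / 2 : ℂ) * (fderiv ℝ f z 1 + Complex.I * fderiv ℝ f z Complex.I)

/-- The Laplacian of a real-valued function of one complex variable. -/
def lapC (φ : ℂ → ℝ) (z : ℂ) : ℝ :=
  fderiv ℝ (fun w => fderiv ℝ φ w 1) z 1 +
    fderiv ℝ (fun w => fderiv ℝ φ w Complex.I) z Complex.I

open MeasureTheory

theorem HasCompactSupport.integrable_fderiv_apply {g : ℂ → ℝ} (hg : ContDiff ℝ 1 g)
    (hc : HasCompactSupport g) (v : ℂ) : Integrable (fun z => fderiv ℝ g z v) :=
  ((hg.continuous_fderiv one_ne_zero).clm_apply continuous_const).integrable_of_hasCompactSupport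
    (hc.fderiv_apply (𝕜 := ℝ) v)

/-- The integral of a directional derivative of a compactly supported `C¹` function vanishes. -/
theorem HasCompactSupport.integral_fderiv_apply_eq_zero {g : ℂ → ℝ} (hg : ContDiff ℝ 1 g)
    (hc : HasCompactSupport g) (v : ℂ) : ∫ z, fderiv ℝ g z v = 0 := by
  have key := integral_mul_fderiv_eq_neg_fderiv_mul_of_integrable (μ := (volume : Measure ℂ))
    (f := fun _ => (1 : ℝ)) (g := g) (v := v) (by simp)
    (by simpa using hc.integrable_fderiv_apply hg v)
    (by simpa using hg.continuous.integrable_of_hasCompactSupport hc)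
    (fun _ _ => differentiableAt_const _) (fun z _ => hg.differentiable one_ne_zero z)
  simpa using key

theorem ContDiff.fderiv_fderiv_apply_comm {q : ℂ → ℝ} (hq : ContDiff ℝ 2 q) (v w z : ℂ) :
    fderiv ℝ (fun y => fderiv ℝ q y v) z w = fderiv ℝ (fun y => fderiv ℝ q y w) z v := by
  have hd : DifferentiableAt ℝ (fderiv ℝ q) z :=
    (hq.fderiv_right (m := 1) le_rfl).differentiable one_ne_zero z
  rw [fderiv_clm_apply hd (differentiableAt_const v), fderiv_clm_apply hd (differentiableAt_const w)]
  simpa using (hq.contDiffAt.isSymmSndFDerivAt (by simp)) w v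

/-- The square of the modulus of the conjugated operator `e^{φ/h} (2h/i) ∂̄(e^{-φ/h} u)`, in terms
of the first derivatives of `φ` and of the real and imaginary parts of `u`. -/
theorem norm_sq_conj_dbar {u : ℂ → ℂ} {φ : ℂ → ℝ} {z : ℂ} (hu : DifferentiableAt ℝ u z)
    (hφ : DifferentiableAt ℝ φ z) {h : ℝ} (hh : h ≠ 0) :
    ‖Complex.exp ((φ z : ℂ) / (h : ℂ)) * (2 * (h : ℂ) / Complex.I) *
        dbar (fun w => Complex.exp (-(φ w : ℂ) / (h : ℂ)) * u w) z‖ ^ 2 =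
      (h * (fderiv ℝ u z 1).re - fderiv ℝ φ z 1 * (u z).re - h * (fderiv ℝ u z Complex.I).im +
          fderiv ℝ φ z Complex.I * (u z).im) ^ 2 +
        (h * (fderiv ℝ u z 1).im - fderiv ℝ φ z 1 * (u z).im + h * (fderiv ℝ u z Complex.I).re -
          fderiv ℝ φ z Complex.I * (u z).re) ^ 2 := by
  have hh' : (h : ℂ) ≠ 0 := by exact_mod_cast hh
  have hφ' : HasFDerivAt (fun w => (φ w : ℂ)) (Complex.ofRealCLM.comp (fderiv ℝ φ z)) z :=
    Complex.ofRealCLM.hasFDerivAt.comp z hφ.hasFDerivAt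
  have hd (v : ℂ) : fderiv ℝ (fun w => Complex.exp (-(φ w : ℂ) / (h : ℂ)) * u w) z v =
      Complex.exp (-(φ z : ℂ) / (h : ℂ)) *
        (fderiv ℝ u z v - (fderiv ℝ φ z v : ℂ) / h * u z) := by
    have hf : HasFDerivAt (fun w => Complex.exp (-(φ w : ℂ) / (h : ℂ)) * u w) _ z :=
      ((hφ'.neg.mul_const ((h : ℂ)⁻¹)).cexp).mul hu.hasFDerivAt
    rw [hf.fderiv]
    simp [div_eq_mul_inv]
    ring
  have hexp : Complex.exp ((φ z : ℂ) / h) * Complex.exp (-(φ z : ℂ) / h) = 1 := by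
    rw [← Complex.exp_add, neg_div, add_neg_cancel, Complex.exp_zero]
  have hP : Complex.exp ((φ z : ℂ) / (h : ℂ)) * (2 * (h : ℂ) / Complex.I) *
        dbar (fun w => Complex.exp (-(φ w : ℂ) / (h : ℂ)) * u w) z =
      -Complex.I * ((h * fderiv ℝ u z 1 - fderiv ℝ φ z 1 * u z) +
        Complex.I * (h * fderiv ℝ u z Complex.I - fderiv ℝ φ z Complex.I * u z)) := by
    rw [dbar, hd, hd, Complex.div_I]
    calc _ = (Complex.exp ((φ z : ℂ) / h) * Complex.exp (-(φ z : ℂ) / h)) * (-Complex.I *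
          ((h * fderiv ℝ u z 1 - h * ((fderiv ℝ φ z 1 : ℂ) / h) * u z) +
          Complex.I * (h * fderiv ℝ u z Complex.I -
            h * ((fderiv ℝ φ z Complex.I : ℂ) / h) * u z))) := by ring
      _ = _ := by rw [hexp, one_mul, mul_div_cancel₀ _ hh', mul_div_cancel₀ _ hh']
  rw [hP, norm_mul, norm_neg, Complex.norm_I, one_mul, Complex.sq_norm, Complex.normSq_apply]
  simp
  ring

/-- The pointwise form of the Carleman estimate, up to a divergence. -/
theorem lapC_mul_norm_sq_le {u : ℂ → ℂ} {φ : ℂ → ℝ} (hu : ContDiff ℝ 2 u) (hφ : ContDiff ℝ 2 φ)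
    {h : ℝ} (hh : h ≠ 0) (z : ℂ) :
    h * (lapC φ z * ‖u z‖ ^ 2) ≤
      ‖Complex.exp ((φ z : ℂ) / (h : ℂ)) * (2 * (h : ℂ) / Complex.I) *
        dbar (fun w => Complex.exp (-(φ w : ℂ) / (h : ℂ)) * u w) z‖ ^ 2 +
      h * (fderiv ℝ (fun w => ((u w).re ^ 2 + (u w).im ^ 2) * fderiv ℝ φ w 1 +
          2 * h * (u w).re * fderiv ℝ (fun y => (u y).im) w Complex.I) z 1 +
        fderiv ℝ (fun w => ((u w).re ^ 2 + (u w).im ^ 2) * fderiv ℝ φ w Complex.I -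
          2 * h * (u w).re * fderiv ℝ (fun y => (u y).im) w 1) z Complex.I) := by
  have hud : DifferentiableAt ℝ u z := hu.differentiable two_ne_zero z
  have hp : HasFDerivAt (fun w => (u w).re) (Complex.reCLM.comp (fderiv ℝ u z)) z :=
    Complex.reCLM.hasFDerivAt.comp z hud.hasFDerivAt
  have hq : HasFDerivAt (fun w => (u w).im) (Complex.imCLM.comp (fderiv ℝ u z)) z :=
    Complex.imCLM.hasFDerivAt.comp z hud.hasFDerivAt
  have hqc : ContDiff ℝ 2 (fun w => (u w).im) := Complex.imCLM.contDiff.comp hu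
  have hd {f : ℂ → ℝ} (hf : ContDiff ℝ 2 f) (v : ℂ) :
      HasFDerivAt (fun w => fderiv ℝ f w v) (fderiv ℝ (fun w => fderiv ℝ f w v) z) z :=
    (((hf.fderiv_right (m := 1) le_rfl).clm_apply contDiff_const).differentiable
      one_ne_zero z).hasFDerivAt
  have hs := (hp.pow 2).add (hq.pow 2)
  have h1 : HasFDerivAt (fun w => ((u w).re ^ 2 + (u w).im ^ 2) * fderiv ℝ φ w 1 +
      2 * h * (u w).re * fderiv ℝ (fun y => (u y).im) w Complex.I) _ z :=
    (hs.mul (hd hφ 1)).add ((hp.const_mul (2 * h)).mul (hd hqc Complex.I))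
  have h2 : HasFDerivAt (fun w => ((u w).re ^ 2 + (u w).im ^ 2) * fderiv ℝ φ w Complex.I -
      2 * h * (u w).re * fderiv ℝ (fun y => (u y).im) w 1) _ z :=
    (hs.mul (hd hφ Complex.I)).sub ((hp.const_mul (2 * h)).mul (hd hqc 1))
  rw [norm_sq_conj_dbar hud (hφ.differentiable two_ne_zero z) hh, h1.fderiv, h2.fderiv,
    Complex.sq_norm, Complex.normSq_apply, lapC]
  have hsymm := hqc.fderiv_fderiv_apply_comm 1 Complex.I z
  simp [hq.fderiv, hsymm]
  set a := fderiv ℝ u z 1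
  set b := fderiv ℝ u z Complex.I
  set r := fderiv ℝ φ z 1
  set s := fderiv ℝ φ z Complex.I
  linarith [sq_nonneg (h * a.im - s * (u z).re), sq_nonneg (h * a.re + s * (u z).im),
    sq_nonneg (h * b.im + r * (u z).re), sq_nonneg (h * b.re - r * (u z).im)]

/-- Carleman estimate for `∂̄`: for `u ∈ C_0^∞(Z)`, smooth `φ` with bounded
Laplacian and `h > 0`, the conjugated operator `P_h u = e^{φ/h} (2h/i) ∂̄(e^{−φ/h} u)` satisfies
`‖P_h u‖²_{L²(Z)} ≥ h ⟨(Δφ) u, u⟩_{L²(Z)}`. -/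
theorem carleman_estimate_dbar (Z : Set ℂ) (hZ : IsOpen Z)
    (u : ℂ → ℂ) (hu : ContDiff ℝ (⊤ : ℕ∞) u) (husupp : HasCompactSupport u)
    (huZ : tsupport u ⊆ Z)
    (φ : ℂ → ℝ) (hφ : ContDiff ℝ (⊤ : ℕ∞) φ) (M : ℝ) (hlap : ∀ z, |lapC φ z| ≤ M)
    (h : ℝ) (hh : 0 < h) :
    h * ∫ z in Z, lapC φ z * ‖u z‖ ^ 2 ≤
      ∫ z in Z, ‖Complex.exp ((φ z : ℂ) / (h : ℂ)) * (2 * (h : ℂ) / Complex.I) *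
        dbar (fun w => Complex.exp (-(φ w : ℂ) / (h : ℂ)) * u w) z‖ ^ 2 := by
  have hu2 : ContDiff ℝ 2 u := contDiff_infty.1 hu 2
  have hφ2 : ContDiff ℝ 2 φ := contDiff_infty.1 hφ 2
  set P : ℂ → ℝ := fun z =>
    ‖Complex.exp ((φ z : ℂ) / (h : ℂ)) * (2 * (h : ℂ) / Complex.I) *
      dbar (fun w => Complex.exp (-(φ w : ℂ) / (h : ℂ)) * u w) z‖ ^ 2 with hP
  have hu0 {z : ℂ} (hz : z ∉ tsupport u) : u z = 0 := image_eq_zero_of_notMem_tsupport hz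
  have hdu0 {z : ℂ} (hz : z ∉ tsupport u) : fderiv ℝ u z = 0 :=
    image_eq_zero_of_notMem_tsupport fun hz' => hz (tsupport_fderiv_subset ℝ hz')
  have hPz (z : ℂ) := norm_sq_conj_dbar (hu2.differentiable two_ne_zero z)
    (hφ2.differentiable two_ne_zero z) hh.ne'
  have hP0 {z : ℂ} (hz : z ∉ tsupport u) : P z = 0 := by
    simp only [hP, hPz, hu0 hz, hdu0 hz]
    simp
  have hd {F : Type} [NormedAddCommGroup F] [NormedSpace ℝ F] {f : ℂ → F} (hf : ContDiff ℝ 2 f)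
      (v : ℂ) : ContDiff ℝ 1 (fun w => fderiv ℝ f w v) :=
    (hf.fderiv_right (m := 1) le_rfl).clm_apply contDiff_const
  have hre : ContDiff ℝ 2 (fun w => (u w).re) := Complex.reCLM.contDiff.comp hu2
  have him : ContDiff ℝ 2 (fun w => (u w).im) := Complex.imCLM.contDiff.comp hu2
  have hPi : Integrable P := by
    refine Continuous.integrable_of_hasCompactSupport ?_ (HasCompactSupport.intro husupp
      fun z hz => hP0 hz)
    simp only [hP, hPz]
    have := hu2.continuous
    have := (hd hu2 1).continuous
    have := (hd hu2 Complex.I).continuous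
    have := (hd hφ2 1).continuous
    have := (hd hφ2 Complex.I).continuous
    fun_prop
  have hLi : Integrable (fun z => lapC φ z * ‖u z‖ ^ 2) := by
    refine Continuous.integrable_of_hasCompactSupport ?_ (HasCompactSupport.intro husupp
      fun z hz => by simp [hu0 hz])
    have hl : Continuous (lapC φ) :=
      (((hd hφ2 1).continuous_fderiv one_ne_zero).clm_apply continuous_const).add
        (((hd hφ2 Complex.I).continuous_fderiv one_ne_zero).clm_apply continuous_const)
    exact hl.mul (hu2.continuous.norm.pow 2)
  set V : ℂ → ℝ := fun w => ((u w).re ^ 2 + (u w).im ^ 2) * fderiv ℝ φ w 1 +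
    2 * h * (u w).re * fderiv ℝ (fun y => (u y).im) w Complex.I with hV
  set W : ℂ → ℝ := fun w => ((u w).re ^ 2 + (u w).im ^ 2) * fderiv ℝ φ w Complex.I -
    2 * h * (u w).re * fderiv ℝ (fun y => (u y).im) w 1 with hW
  have hsq : ContDiff ℝ 1 (fun w => (u w).re ^ 2 + (u w).im ^ 2) :=
    ((hre.pow 2).add (him.pow 2)).of_le one_le_two
  have hre1 : ContDiff ℝ 1 (fun w => 2 * h * (u w).re) :=
    contDiff_const.mul (hre.of_le one_le_two)
  have hVc : ContDiff ℝ 1 V := (hsq.mul (hd hφ2 1)).add (hre1.mul (hd him Complex.I))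
  have hWc : ContDiff ℝ 1 W := (hsq.mul (hd hφ2 Complex.I)).sub (hre1.mul (hd him 1))
  have hVs : HasCompactSupport V := .intro husupp fun z hz => by simp [hV, hu0 hz]
  have hWs : HasCompactSupport W := .intro husupp fun z hz => by simp [hW, hu0 hz]
  have hVi := hVs.integrable_fderiv_apply hVc 1
  have hWi := hWs.integrable_fderiv_apply hWc Complex.I
  have hdiv : Integrable (fun z => h * (fderiv ℝ V z 1 + fderiv ℝ W z Complex.I)) :=
    (hVi.add hWi).const_mul h
  rw [setIntegral_eq_integral_of_forall_compl_eq_zero fun z hz => by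
      simp [hu0 fun hz' => hz (huZ hz')],
    setIntegral_eq_integral_of_forall_compl_eq_zero fun z hz => hP0 fun hz' => hz (huZ hz'),
    ← integral_const_mul]
  calc ∫ z, h * (lapC φ z * ‖u z‖ ^ 2)
      ≤ ∫ z, (P z + h * (fderiv ℝ V z 1 + fderiv ℝ W z Complex.I)) :=
        integral_mono (hLi.const_mul h) (hPi.add hdiv) (lapC_mul_norm_sq_le hu2 hφ2 hh.ne')
    _ = ∫ z, P z := by
        rw [integral_add hPi hdiv, integral_const_mul,
          integral_add hVi hWi,
          hVs.integral_fderiv_apply_eq_zero hVc, hWs.integral_fderiv_apply_eq_zero hWc]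
        simp
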